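/- Let n ≥ 3 and let m be a positive integer with 2(q+1)m > (q^{n-2}−1)/(q−1). Then A^r_q(n, n−2, n−3; 2) ≤ floor( ((q^n−1)/(q−1)) · m(m+1) / ( 2(q+1)m − (q^{n-2}−1)/(q−1) ) ). -/

import Mathlib

open scoped Classical

def gaussBinom (q : ℕ) : ℕ → ℕ → ℕ
  | _, 0 => 1
  | 0, _ + 1 => 0
  | n + 1, k + 1 => gaussBinom q n k + q ^ (k + 1) * gaussBinom q n (k + 1)

def IsPacking (F : Type) [Field F] [Fintype F] (n k t lam : ℕ)
    (S : Finset (Submodule F (Fin n → F))) : Prop :=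
  (∀ U ∈ S, Module.finrank F U = k) ∧
    ∀ T : Submodule F (Fin n → F), Module.finrank F T = t →
      (S.filter fun U => T ≤ U).card ≤ lam

noncomputable def packingNumber (F : Type) [Field F] [Fintype F] (n k t lam : ℕ) : ℕ :=
  sSup {m | ∃ S : Finset (Submodule F (Fin n → F)), IsPacking F n k t lam S ∧ S.card = m}

def IsRPacking (F : Type) [Field F] [Fintype F] (n k t lam : ℕ)
    (S : Multiset (Submodule F (Fin n → F))) : Prop :=
  (∀ U ∈ S, Module.finrank F U = k) ∧
    ∀ T : Submodule F (Fin n → F), Module.finrank F T = t →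
      (S.countP fun U => T ≤ U) ≤ lam

noncomputable def rPackingNumber (F : Type) [Field F] [Fintype F] (n k t lam : ℕ) : ℕ :=
  sSup {m | ∃ S : Multiset (Submodule F (Fin n → F)), IsRPacking F n k t lam S ∧ Multiset.card S = m}


section helpers

variable {F : Type} [Field F] [Fintype F] {E : Type} [AddCommGroup E] [Module F E] [Fintype E]

lemma ind_sum (U : Submodule F E) :
    ∑ f ∈ Finset.univ.erase (0 : E), (if f ∈ U then (1 : ℤ) else 0) =
      (Fintype.card F : ℤ) ^ Module.finrank F U - 1 := by
  have h1 : ∑ f : E, (if f ∈ U then (1 : ℤ) else 0) =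
      (Fintype.card F : ℤ) ^ Module.finrank F U := by
    rw [Finset.sum_boole]
    have := Module.card_eq_pow_finrank (K := F) (V := U)
    rw [Fintype.card_subtype] at this
    exact_mod_cast this
  rw [← Finset.add_sum_erase _ _ (Finset.mem_univ (0 : E))] at h1
  simp only [U.zero_mem, if_true] at h1
  linarith

lemma exists_three (U : Submodule F E) (hU : 2 ≤ Module.finrank F U)
    (hU3 : Module.finrank F U ≤ 3) (hE : 4 ≤ Module.finrank F E) :
    ∃ T : Submodule F E, Module.finrank F T = 3 ∧ U ≤ T := by
  by_cases h : Module.finrank F U = 3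
  · exact ⟨U, h, le_rfl⟩
  have hne : U ≠ ⊤ := by
    rintro rfl
    rw [finrank_top] at hU3
    omega
  obtain ⟨x, -, hx⟩ := SetLike.exists_of_lt (lt_top_iff_ne_top.mpr hne)
  refine ⟨U ⊔ Submodule.span F {x}, ?_, le_sup_left⟩
  have h1 : U < U ⊔ Submodule.span F {x} := by
    refine lt_of_le_of_ne le_sup_left fun h' => hx ?_
    rw [h']
    exact Submodule.mem_sup_right (Submodule.mem_span_singleton_self x)
  have h2 := Submodule.finrank_lt_finrank_of_lt h1
  have h3 := Submodule.finrank_sup_add_finrank_inf_eq U (Submodule.span F {x})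
  have h4 : Module.finrank F (Submodule.span F {x}) ≤ 1 := (finrank_span_le_card ({x} : Set E)).trans (by simp)
  omega

lemma no_three {ι : Type} [Fintype ι] (A : ι → Submodule F E)
    (hT : ∀ T : Submodule F E, Module.finrank F T = 3 →
      (Finset.univ.filter fun i => A i ≤ T).card ≤ 2)
    (T : Submodule F E) (h3 : Module.finrank F T = 3) (a b c : ι) (hab : b ≠ a) (hac : c ≠ a)
    (hbc : c ≠ b) (ha : A a ≤ T) (hb : A b ≤ T) (hc : A c ≤ T) : False := by
  have h := hT T h3
  have : ({a, b, c} : Finset ι) ⊆ Finset.univ.filter fun i => A i ≤ T := by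
    intro i hi
    simp only [Finset.mem_insert, Finset.mem_singleton] at hi
    rcases hi with rfl | rfl | rfl <;> simpa
  have h' := Finset.card_le_card this
  rw [Finset.card_eq_three.mpr ⟨a, b, c, hab.symm, hac.symm, hbc.symm, rfl⟩] at h'
  omega

lemma fixed_bound {ι : Type} [Fintype ι] (n : ℕ) (hn : 4 ≤ n) (hE : Module.finrank F E = n)
    (A : ι → Submodule F E) (hA : ∀ i, Module.finrank F (A i) = 2)
    (hT : ∀ T : Submodule F E, Module.finrank F T = 3 →
      (Finset.univ.filter fun i => A i ≤ T).card ≤ 2) (a : ι) :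
    ∑ b ∈ Finset.univ.erase a, ((Fintype.card F : ℤ) ^ Module.finrank F (A a ⊓ A b : Submodule F E) - 1)
      ≤ (Fintype.card F : ℤ) ^ (n - 2) - 1 := by
  have hq : 2 ≤ Fintype.card F := Fintype.one_lt_card
  set q := Fintype.card F with hqdef
  have hq' : (2 : ℤ) ≤ q := by exact_mod_cast hq
  have hdim : ∀ b, A a ⊓ A b ≠ ⊥ → 2 ≤ Module.finrank F (A a ⊔ A b : Submodule F E) ∧
      Module.finrank F (A a ⊔ A b : Submodule F E) ≤ 3 := by
    intro b hb
    have h1 := Submodule.finrank_sup_add_finrank_inf_eq (A a) (A b)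
    have h2 : Module.finrank F (A a ⊓ A b : Submodule F E) ≠ 0 := by
      rwa [Ne, Submodule.finrank_eq_zero]
    have h3 := Submodule.finrank_mono (le_sup_left : A a ≤ A a ⊔ A b)
    have := hA a
    have := hA b
    omega
  by_cases hex : ∃ b, b ≠ a ∧ A b = A a
  · obtain ⟨b, hba, hb⟩ := hex
    rw [Finset.sum_eq_single b]
    · rw [hb, inf_idem, hA]
      have : (q : ℤ) ^ 2 ≤ (q : ℤ) ^ (n - 2) := pow_le_pow_right₀ (by linarith) (by omega)
      linarith
    · intro c hc hcb
      have hca := Finset.ne_of_mem_erase hc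
      have : A a ⊓ A c = ⊥ := by
        by_contra hne
        obtain ⟨T, hT3, hle⟩ := exists_three _ (hdim c hne).1 (hdim c hne).2 (by omega)
        have ha := le_sup_left.trans hle
        exact no_three A hT T hT3 a b c hba hca hcb ha (hb ▸ ha) (le_sup_right.trans hle)
      rw [this]
      simp
    · intro h
      exact absurd (Finset.mem_erase.mpr ⟨hba, Finset.mem_univ _⟩) h
  · push Not at hex
    set P := (Finset.univ.erase a).filter fun b => A a ⊓ A b ≠ ⊥ with hP
    have hPd : ∀ b ∈ P, Module.finrank F (A a ⊓ A b : Submodule F E) = 1 ∧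
        Module.finrank F (A a ⊔ A b : Submodule F E) = 3 := by
      intro b hb
      simp only [hP, Finset.mem_filter, Finset.mem_erase, Finset.mem_univ, and_true] at hb
      have h1 := Submodule.finrank_sup_add_finrank_inf_eq (A a) (A b)
      have h2 := hdim b hb.2
      have h3 : A a < A a ⊔ A b := by
        refine lt_of_le_of_ne le_sup_left fun h => hex b hb.1 ?_
        have h5 : A b ≤ A a := by rw [h]; exact le_sup_right
        exact Submodule.eq_of_le_of_finrank_eq h5 (by rw [hA, hA])
      have h4 := Submodule.finrank_lt_finrank_of_lt h3
      have := hA a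
      have := hA b
      omega
    have hsum : ∑ b ∈ Finset.univ.erase a,
        ((q : ℤ) ^ Module.finrank F (A a ⊓ A b : Submodule F E) - 1) = P.card * ((q : ℤ) - 1) := by
      rw [← nsmul_eq_mul, ← Finset.sum_const]
      rw [← Finset.sum_filter_of_ne (p := fun b => A a ⊓ A b ≠ ⊥)]
      · refine Finset.sum_congr rfl fun b hb => ?_
        rw [(hPd b hb).1, pow_one]
      · intro b _ h h0
        apply h
        rw [h0]
        simp
    rw [hsum]
    have hcard : ∀ U : Submodule F E, (Finset.univ.filter fun x => x ∈ U).card =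
        q ^ Module.finrank F U := by
      intro U
      have := Module.card_eq_pow_finrank (K := F) (V := U)
      rwa [Fintype.card_subtype] at this
    let D : ι → Finset E := fun b =>
      (Finset.univ.filter fun x => x ∈ A a ⊔ A b) \ (Finset.univ.filter fun x => x ∈ A a)
    have hsub : ∀ b, (Finset.univ.filter fun x => x ∈ A a) ⊆
        (Finset.univ.filter fun x => x ∈ A a ⊔ A b) := by
      intro b x hx
      simp only [Finset.mem_filter, Finset.mem_univ, true_and] at hx ⊢
      exact Submodule.mem_sup_left hx
    have hD : ∀ b ∈ P, ((D b).card : ℤ) = (q : ℤ) ^ 3 - (q : ℤ) ^ 2 := by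
      intro b hb
      rw [Finset.cast_card_sdiff (hsub b), hcard, hcard, (hPd b hb).2, hA]
      push_cast
      rfl
    have hdisj : ∀ b ∈ P, ∀ c ∈ P, b ≠ c → Disjoint (D b) (D c) := by
      intro b hb c hc hbc
      rw [Finset.disjoint_left]
      intro x hxb hxc
      simp only [D, Finset.mem_sdiff, Finset.mem_filter, Finset.mem_univ, true_and] at hxb hxc
      have h1 : A a < (A a ⊔ A b) ⊓ (A a ⊔ A c) := by
        refine lt_of_le_of_ne (le_inf le_sup_left le_sup_left) fun h => hxb.2 ?_
        rw [h]
        exact ⟨hxb.1, hxc.1⟩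
      have h2 := Submodule.finrank_lt_finrank_of_lt h1
      have h3 : (A a ⊔ A b) ⊓ (A a ⊔ A c) = A a ⊔ A b := by
        refine Submodule.eq_of_le_of_finrank_le inf_le_left ?_
        rw [(hPd b hb).2]
        have := hA a
        omega
      have h4 : A c ≤ A a ⊔ A b := by
        have h5 : A a ⊔ A b = A a ⊔ A c := by
          refine Submodule.eq_of_le_of_finrank_eq (inf_eq_left.mp h3) ?_
          rw [(hPd b hb).2, (hPd c hc).2]
        rw [h5]
        exact le_sup_right
      have hba : b ≠ a := Finset.ne_of_mem_erase (Finset.mem_filter.mp hb).1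
      have hca : c ≠ a := Finset.ne_of_mem_erase (Finset.mem_filter.mp hc).1
      exact no_three A hT _ (hPd b hb).2 a b c hba hca hbc.symm le_sup_left le_sup_right h4
    have hle : ((P.biUnion D).card : ℤ) ≤ (q : ℤ) ^ n - (q : ℤ) ^ 2 := by
      have h1 : P.biUnion D ⊆ Finset.univ \ (Finset.univ.filter fun x => x ∈ A a) := by
        intro x hx
        obtain ⟨b, _, hxb⟩ := Finset.mem_biUnion.mp hx
        exact Finset.mem_sdiff.mpr ⟨Finset.mem_univ _, (Finset.mem_sdiff.mp hxb).2⟩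
      have h2 : ((P.biUnion D).card : ℤ) ≤
          ((Finset.univ \ (Finset.univ.filter fun x => x ∈ A a)).card : ℤ) := by
        exact_mod_cast Finset.card_le_card h1
      rw [Finset.cast_card_sdiff (Finset.subset_univ _), hcard, hA, Finset.card_univ,
        Module.card_eq_pow_finrank (K := F) (V := E), hE] at h2
      exact_mod_cast h2
    rw [Finset.card_biUnion hdisj] at hle
    push_cast at hle
    rw [Finset.sum_congr rfl hD, Finset.sum_const, nsmul_eq_mul] at hle
    have hpow : (q : ℤ) ^ n = (q : ℤ) ^ 2 * (q : ℤ) ^ (n - 2) := by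
      rw [← pow_add]
      congr 1
      omega
    rw [hpow] at hle
    have hq2 : (0 : ℤ) < (q : ℤ) ^ 2 := by positivity
    refine le_of_mul_le_mul_left ?_ hq2
    linarith

lemma core {ι : Type} [Fintype ι] (n : ℕ) (hn : 4 ≤ n) (hE : Module.finrank F E = n)
    (A : ι → Submodule F E) (hA : ∀ i, Module.finrank F (A i) = 2)
    (hT : ∀ T : Submodule F E, Module.finrank F T = 3 →
      (Finset.univ.filter fun i => A i ≤ T).card ≤ 2) (m : ℤ) :
    (Fintype.card ι : ℤ) * (2 * m * ((Fintype.card F : ℤ) ^ 2 - 1)) ≤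
      Fintype.card ι * ((Fintype.card F : ℤ) ^ (n - 2) - 1) +
        m * (m + 1) * ((Fintype.card F : ℤ) ^ n - 1) := by
  have hb := fixed_bound n hn hE A hA hT
  set q := Fintype.card F with hqdef
  let N : E → ℤ := fun f => ∑ b, (if f ∈ A b then (1 : ℤ) else 0)
  have h1 : ∑ f ∈ Finset.univ.erase (0 : E), N f = Fintype.card ι * ((q : ℤ) ^ 2 - 1) := by
    simp only [N]
    rw [Finset.sum_comm, Finset.sum_congr rfl fun b _ => ind_sum (A b)]
    simp [hA, hqdef]
    ring
  have h2 : ∑ f ∈ Finset.univ.erase (0 : E), N f * N f =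
      ∑ a, ∑ b, ((q : ℤ) ^ Module.finrank F (A a ⊓ A b : Submodule F E) - 1) := by
    simp only [N, Finset.sum_mul_sum]
    rw [Finset.sum_comm]
    refine Finset.sum_congr rfl fun a _ => ?_
    rw [Finset.sum_comm]
    refine Finset.sum_congr rfl fun b _ => ?_
    rw [← ind_sum]
    refine Finset.sum_congr rfl fun f _ => ?_
    by_cases ha : f ∈ A a <;> by_cases hb : f ∈ A b <;> simp [ha, hb]
  have h3 : ∑ f ∈ Finset.univ.erase (0 : E), N f * N f ≤
      Fintype.card ι * (((q : ℤ) ^ 2 - 1) + ((q : ℤ) ^ (n - 2) - 1)) := by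
    rw [h2, ← nsmul_eq_mul]
    have : Fintype.card ι = (Finset.univ : Finset ι).card := rfl
    rw [this]
    refine Finset.sum_le_card_nsmul _ _ _ fun a _ => ?_
    rw [← Finset.add_sum_erase _ _ (Finset.mem_univ a), inf_idem, hA]
    linarith [hb a]
  have h4 : ∑ f ∈ Finset.univ.erase (0 : E), (1 : ℤ) = (q : ℤ) ^ n - 1 := by
    have := ind_sum (⊤ : Submodule F E)
    simpa only [Submodule.mem_top, if_true, finrank_top, hE] using this
  have h5 : 0 ≤ ∑ f ∈ Finset.univ.erase (0 : E),
      (N f * N f - (2 * m + 1) * N f + m * (m + 1) * 1) := by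
    refine Finset.sum_nonneg fun f _ => ?_
    rcases le_or_gt (N f) m with h | h
    · nlinarith
    · have : m + 1 ≤ N f := h
      nlinarith
  rw [Finset.sum_add_distrib, Finset.sum_sub_distrib, ← Finset.mul_sum, ← Finset.mul_sum, h1, h4]
    at h5
  linarith

end helpers

lemma geom_div (q k : ℕ) (hq : 2 ≤ q) :
    (((q ^ k - 1) / (q - 1) : ℕ) : ℤ) * ((q : ℤ) - 1) = (q : ℤ) ^ k - 1 := by
  have h : (q - 1) ∣ (q ^ k - 1) := Nat.sub_one_dvd_pow_sub_one q k
  have h1 := Nat.div_mul_cancel h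
  have h2 : 1 ≤ q ^ k := Nat.one_le_pow _ _ (by omega)
  zify [h2, (by omega : 1 ≤ q)] at h1 ⊢
  exact h1

theorem stmt13 (q n m : ℕ) (F : Type) [Field F] [Fintype F] (hq : Fintype.card F = q)
    (hn : 3 ≤ n) (hm : 1 ≤ m) (hcond : 2 * (q + 1) * m > (q ^ (n - 2) - 1) / (q - 1)) :
    rPackingNumber F n (n - 2) (n - 3) 2 ≤
      (q ^ n - 1) / (q - 1) * (m * (m + 1)) /
        (2 * (q + 1) * m - (q ^ (n - 2) - 1) / (q - 1)) := by
  have hq2 : 2 ≤ q := hq ▸ Fintype.one_lt_card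
  refine csSup_le' ?_
  rintro _ ⟨C, ⟨hk, hc⟩, rfl⟩
  rw [Nat.le_div_iff_mul_le (by omega)]
  have g1 := geom_div q n hq2
  have g2 := geom_div q (n - 2) hq2
  have hq2' : (2 : ℤ) ≤ q := by exact_mod_cast hq2
  have hm' : (1 : ℤ) ≤ m := by exact_mod_cast hm
  have hpos : (0 : ℤ) < (q : ℤ) - 1 := by linarith
  generalize (q ^ n - 1) / (q - 1) = x at *
  generalize (q ^ (n - 2) - 1) / (q - 1) = y at *
  zify [hcond.le]
  refine le_of_mul_le_mul_right ?_ hpos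
  rcases Nat.lt_or_ge n 4 with h4 | h4
  · obtain rfl : n = 3 := by omega
    have hC : Multiset.card C ≤ 2 := by
      have := hc ⊥ (by simp)
      simpa using this
    have hC' : ((Multiset.card C : ℕ) : ℤ) ≤ 2 := by exact_mod_cast hC
    have hy : (y : ℤ) = 1 := by
      have : ((y : ℤ) - 1) * ((q : ℤ) - 1) = 0 := by
        norm_num at g2
        linarith
      rcases mul_eq_zero.mp this with h | h <;> linarith
    have hx : (x : ℤ) = q ^ 2 + q + 1 := by
      have : ((x : ℤ) - (q ^ 2 + q + 1)) * ((q : ℤ) - 1) = 0 := by linarith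
      rcases mul_eq_zero.mp this with h | h <;> linarith
    refine mul_le_mul_of_nonneg_right ?_ hpos.le
    rw [hx, hy]
    have e1 : (0 : ℤ) ≤ 2 * (q + 1) * m - 1 := by nlinarith
    have e2 : ((Multiset.card C : ℕ) : ℤ) * (2 * (q + 1) * m - 1) ≤ 2 * (2 * (q + 1) * m - 1) :=
      mul_le_mul_of_nonneg_right hC' e1
    have e3 : ((q : ℤ) ^ 2 + q + 1) * (m * 2) ≤ (q ^ 2 + q + 1) * (m * (m + 1)) := by
      gcongr
      linarith
    have e4 : (2 * ((q : ℤ) + 1)) * (m * 2) ≤ (q ^ 2 + q + 1) * (m * 2) := by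
      gcongr
      nlinarith
    linarith
  · have hfin : Finite (Module.Dual F (Fin n → F)) := Module.finite_of_finite F
    have : Fintype (Module.Dual F (Fin n → F)) := Fintype.ofFinite _
    have hd : Module.finrank F (Module.Dual F (Fin n → F)) = n := by
      rw [Subspace.dual_finrank_eq]; simp
    have key := core (F := F) (E := Module.Dual F (Fin n → F)) (ι := C) n h4 hd
      (fun i => (i.1 : Submodule F (Fin n → F)).dualAnnihilator) ?_ ?_ (m : ℤ)
    · rw [Multiset.card_coe, hq, ← g1, ← g2] at key
      linarith
    · intro i
      have h1 := Subspace.finrank_add_finrank_dualAnnihilator_eq (i.1 : Submodule F (Fin n → F))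
      rw [hk i.1 (Multiset.coe_mem), Module.finrank_fin_fun] at h1
      omega
    · intro T hT
      have h1 := Subspace.finrank_add_finrank_dualCoannihilator_eq T
      rw [hT, Module.finrank_fin_fun] at h1
      have h2 := hc T.dualCoannihilator (by omega)
      refine le_trans (le_of_eq ?_) h2
      conv_rhs => rw [← Multiset.map_univ_coe C]
      rw [Multiset.countP_map]
      refine congrArg Multiset.card (Multiset.filter_congr fun i _ => ?_)
      constructor
      · intro h
        have := Submodule.dualCoannihilator_anti h
        rwa [Subspace.dualAnnihilator_dualCoannihilator_eq] at this
      · intro h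
        have := Submodule.dualAnnihilator_anti h
        rwa [Subspace.dualCoannihilator_dualAnnihilator_eq] at this
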